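/- Let D be a simply connected domain which is a connected component of the complement of the image of a continuous curve γ : [0,1] → ℂ. Then the boundary of D is locally connected. -/

import Mathlib

open Set

open Filter Topology in
lemma exp_eq_const {α : Type*} [TopologicalSpace α] {S : Set α} (hS : IsPreconnected S)
    {h₁ h₂ : α → ℂ} (c₁ : ContinuousOn h₁ S) (c₂ : ContinuousOn h₂ S)
    (he : ∀ x ∈ S, Complex.exp (h₁ x) = Complex.exp (h₂ x)) {x y : α} (hx : x ∈ S) (hy : y ∈ S) :
    h₁ x - h₂ x = h₁ y - h₂ y := by
  have key : ∀ x ∈ S, ∀ᶠ y in 𝓝[S] x, h₁ x - h₂ x = h₁ y - h₂ y := by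
    intro x hx
    have hc : Tendsto (fun y => (h₁ y - h₂ y)) (𝓝[S] x) (𝓝 (h₁ x - h₂ x)) :=
      ((c₁.sub c₂) x hx)
    have := hc (Metric.ball_mem_nhds _ Real.two_pi_pos)
    filter_upwards [this, self_mem_nhdsWithin] with y hy hyS
    simp only [mem_preimage, Metric.mem_ball, dist_eq_norm] at hy
    have e1 : Complex.exp ((h₁ y - h₂ y) - (h₁ x - h₂ x)) = 1 := by
      rw [Complex.exp_sub, Complex.exp_sub, Complex.exp_sub, he x hx, he y hyS]
      simp [Complex.exp_ne_zero]
    obtain ⟨n, hn⟩ := Complex.exp_eq_one_iff.1 e1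
    rw [hn] at hy
    have : |(n : ℝ)| * (2 * Real.pi) < 2 * Real.pi := by
      simpa [abs_of_pos Real.pi_pos] using hy
    have h1 : |(n : ℝ)| < 1 := by
      by_contra h
      push Not at h
      nlinarith [Real.pi_pos]
    have h2 : n = 0 := by
      have : |n| < 1 := by exact_mod_cast h1
      exact Int.abs_lt_one_iff.1 this
    rw [h2] at hn
    simp at hn
    exact (sub_eq_zero.1 hn).symm
  refine hS.induction₂' (fun x y => h₁ x - h₂ x = h₁ y - h₂ y) ?_ ?_ hx hy
  · intro x hx
    filter_upwards [key x hx] with y hy using ⟨hy, hy.symm⟩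
  · intro x y z _ _ _ h h'
    exact h.trans h'

lemma exists_log {φ : ℂ → ℂ} (hφ : Continuous φ) (h0 : ∀ z, φ z ≠ 0) :
    ∃ ψ : ℂ → ℂ, Continuous ψ ∧ ∀ z, Complex.exp (ψ z) = φ z := by
  obtain ⟨F, ⟨-, hF⟩, -⟩ := Complex.isCoveringMapOn_exp.existsUnique_continuousMap_lifts
    (⟨φ, hφ⟩ : C(ℂ, ℂ)) (a₀ := 0) (e₀ := Complex.log (φ 0)) (by simp [Complex.exp_log (h0 0)])
    (by simpa using h0)
  exact ⟨F, F.continuous, fun z => congrFun hF z⟩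

/-- `K` does not separate `x` and `y`, in logarithmic form. -/
def NS (K : Set ℂ) (x y : ℂ) : Prop :=
  ∃ g : ℂ → ℂ, ContinuousOn g K ∧ ∀ z ∈ K, z - x = Complex.exp (g z) * (z - y)

lemma NS.mono {K K' : Set ℂ} {x y : ℂ} (h : NS K x y) (hK : K' ⊆ K) : NS K' x y := by
  obtain ⟨g, hg, h⟩ := h
  exact ⟨g, hg.mono hK, fun z hz => h z (hK hz)⟩

lemma NS.trans {K : Set ℂ} {x y w : ℂ} (h : NS K x y) (h' : NS K y w) : NS K x w := by
  obtain ⟨g, hg, h⟩ := h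
  obtain ⟨g', hg', h'⟩ := h'
  refine ⟨fun z => g z + g' z, hg.add hg', fun z hz => ?_⟩
  rw [h z hz, h' z hz, Complex.exp_add]; ring

lemma NS.symm {K : Set ℂ} {x y : ℂ} (h : NS K x y) : NS K y x := by
  obtain ⟨g, hg, h⟩ := h
  refine ⟨fun z => - g z, hg.neg, fun z hz => ?_⟩
  rw [h z hz, ← mul_assoc, ← Complex.exp_add]; simp

lemma log_ball {c x : ℂ} {r : ℝ} (hx : x ∉ Metric.closedBall c r) :
    ∃ g : ℂ → ℂ, ContinuousOn g (Metric.closedBall c r) ∧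
      ∀ z ∈ Metric.closedBall c r, z - x = Complex.exp (g z) := by
  rcases lt_or_ge r 0 with hr | hr
  · simp [Metric.closedBall_eq_empty.2 hr]
  have hx' : r < ‖c - x‖ := by
    simpa [dist_eq_norm, norm_sub_rev] using hx
  have hc : c - x ≠ 0 := norm_pos_iff.1 (hr.trans_lt hx')
  have hs : ∀ z ∈ Metric.closedBall c r, (z - x) / (c - x) ∈ Complex.slitPlane := by
    intro z hz
    apply Complex.ball_one_subset_slitPlane
    have : (z - x) / (c - x) - 1 = (z - c) / (c - x) := by field_simp; ring
    rw [Metric.mem_ball, dist_eq_norm, this, norm_div, div_lt_one (hr.trans_lt hx')]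
    rw [Metric.mem_closedBall, dist_eq_norm] at hz
    exact hz.trans_lt hx'
  refine ⟨fun z => Complex.log ((z - x) / (c - x)) + Complex.log (c - x), ?_, ?_⟩
  · apply ContinuousOn.add _ continuousOn_const
    exact ContinuousOn.clog (by fun_prop) hs
  · intro z hz
    rw [Complex.exp_add, Complex.exp_log (Complex.slitPlane_ne_zero (hs z hz)), Complex.exp_log hc]
    field_simp

lemma ns_ball {c x y : ℂ} {r : ℝ} (hx : x ∉ Metric.closedBall c r)
    (hy : y ∉ Metric.closedBall c r) : NS (Metric.closedBall c r) x y := by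
  obtain ⟨g, hg, h⟩ := log_ball hx
  obtain ⟨g', hg', h'⟩ := log_ball hy
  refine ⟨fun z => g z - g' z, hg.sub hg', fun z hz => ?_⟩
  rw [h z hz, h' z hz, ← Complex.exp_add]; simp

lemma ns_local {K : Set ℂ} {x y : ℂ} {r : ℝ} (hx : ∀ z ∈ K, r ≤ ‖z - x‖) (hr : ‖y - x‖ < r) :
    NS K y x := by
  have h0 : ∀ z ∈ K, z - x ≠ 0 := fun z hz =>
    norm_pos_iff.1 ((norm_nonneg _).trans_lt (hr.trans_le (hx z hz)))
  have hs : ∀ z ∈ K, (z - y) / (z - x) ∈ Complex.slitPlane := by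
    intro z hz
    have h0 := h0 z hz
    apply Complex.ball_one_subset_slitPlane
    have : (z - y) / (z - x) - 1 = -((y - x) / (z - x)) := by field_simp; ring
    rw [Metric.mem_ball, dist_eq_norm, this, norm_neg, norm_div,
      div_lt_one (norm_pos_iff.2 h0)]
    exact hr.trans_le (hx z hz)
  refine ⟨fun z => Complex.log ((z - y) / (z - x)), ?_, ?_⟩
  · exact ContinuousOn.clog (ContinuousOn.div (by fun_prop) (by fun_prop) h0) hs
  · intro z hz
    have h0 := h0 z hz
    rw [Complex.exp_log (Complex.slitPlane_ne_zero (hs z hz))]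
    field_simp

open Filter Topology in
lemma ns_of_preconnected {K S : Set ℂ} (hK : IsClosed K) (hS : IsPreconnected S)
    (hSK : S ⊆ Kᶜ) {x y : ℂ} (hx : x ∈ S) (hy : y ∈ S) : NS K x y := by
  refine hS.induction₂' (fun x y => NS K x y) ?_ ?_ hx hy
  · intro x hx
    obtain ⟨r, hr, hb⟩ := Metric.isOpen_iff.1 hK.isOpen_compl x (hSK hx)
    have : ∀ᶠ y in 𝓝[S] x, y ∈ Metric.ball x r :=
      mem_nhdsWithin_of_mem_nhds (Metric.ball_mem_nhds _ hr)
    filter_upwards [this] with y hy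
    have : NS K y x := by
      refine ns_local (r := r) (fun z hz => ?_) (by simpa [dist_eq_norm] using hy)
      by_contra h
      exact hb (by simpa [dist_eq_norm] using h) hz
    exact ⟨this.symm, this⟩
  · intro x y z _ _ _ h h'
    exact h.trans h'

lemma ns_glue {A B : Set ℂ} (hA : IsClosed A) (hB : IsClosed B) (hAB : IsPreconnected (A ∩ B))
    {x y : ℂ} (hy : y ∉ A ∩ B) (h : NS A x y) (h' : NS B x y) :
    NS (A ∪ B) x y := by
  classical
  obtain ⟨g, hg, h⟩ := h
  obtain ⟨g', hg', h'⟩ := h'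
  obtain ⟨k, hk1, hk⟩ : ∃ k : ℂ, Complex.exp k = 1 ∧ ∀ z ∈ A ∩ B, g z = g' z + k := by
    rcases (A ∩ B).eq_empty_or_nonempty with h0 | ⟨w, hw⟩
    · exact ⟨0, by simp, by simp [h0]⟩
    · have he : ∀ z ∈ A ∩ B, Complex.exp (g z) = Complex.exp (g' z) := by
        intro z hz
        have h1 := h z hz.1
        rw [h' z hz.2] at h1
        refine (mul_right_cancel₀ (sub_ne_zero.2 ?_) h1).symm
        rintro rfl
        exact hy hz
      refine ⟨g w - g' w, ?_, fun z hz => ?_⟩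
      · rw [Complex.exp_sub, he w hw, div_self (Complex.exp_ne_zero _)]
      · rw [← exp_eq_const hAB (hg.mono inter_subset_left) (hg'.mono inter_subset_right) he hz hw]
        ring
  refine ⟨fun z => if z ∈ A then g z else g' z + k, ?_, ?_⟩
  · apply ContinuousOn.union_of_isClosed _ _ hA hB
    · exact hg.congr fun z hz => by simp [hz]
    · refine (hg'.add continuousOn_const).congr (f := fun z => g' z + k) fun z hz => ?_
      by_cases hzA : z ∈ A
      · simp only [hzA, if_true]; exact hk z ⟨hzA, hz⟩
      · simp [hzA]
  · intro z hz
    by_cases hzA : z ∈ A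
    · simpa [hzA] using h z hzA
    · simpa [hzA, Complex.exp_add, hk1] using h' z (hz.resolve_left hzA)

lemma circle_no_log {x : ℂ} {R : ℝ} (hx : ‖x‖ < R) {ψ : ℂ → ℂ}
    (hψ : ContinuousOn ψ (Metric.sphere 0 R)) (h : ∀ z ∈ Metric.sphere (0:ℂ) R, z - x = Complex.exp (ψ z)) :
    False := by
  have hR : 0 < R := (norm_nonneg _).trans_lt hx
  have h1 : NS (Metric.sphere (0:ℂ) R) 0 x := by
    refine ns_of_preconnected Metric.isClosed_sphere (convex_ball (0:ℂ) R).isPreconnected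
      ?_ (by simpa using hR) (by simpa using hx)
    intro z hz hz'
    simp at hz hz'
    linarith
  obtain ⟨g, hg, h1⟩ := h1
  have hm : ∀ t : ℝ, (R : ℂ) * Complex.exp (t * Complex.I) ∈ Metric.sphere (0:ℂ) R := by
    intro t
    simp [Complex.norm_exp_ofReal_mul_I, abs_of_pos hR]
  have := exp_eq_const (S := (univ : Set ℝ)) isPreconnected_univ
    (h₁ := fun t : ℝ => g (R * Complex.exp (t * Complex.I)) + ψ (R * Complex.exp (t * Complex.I)))
    (h₂ := fun t : ℝ => (Real.log R : ℂ) + t * Complex.I)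
    (by
      apply ContinuousOn.add
      · exact hg.comp (by fun_prop) (fun t _ => hm t)
      · exact hψ.comp (by fun_prop) (fun t _ => hm t)) (by fun_prop)
    (by
      intro t _
      rw [Complex.exp_add, ← h _ (hm t), ← h1 _ (hm t), Complex.exp_add, ← Complex.ofReal_exp,
        Real.exp_log hR]; simp) (mem_univ 0) (mem_univ (2 * Real.pi))
  simp at this

lemma exists_ext {K : Set ℂ} (hK : IsClosed K) {g : ℂ → ℂ} (hg : ContinuousOn g K) :
    ∃ G : ℂ → ℂ, Continuous G ∧ ∀ z ∈ K, G z = g z := by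
  have key : ∀ f : ℂ → ℝ, ContinuousOn f K → ∃ F : ℂ → ℝ, Continuous F ∧ ∀ z ∈ K, F z = f z := by
    intro f hf
    obtain ⟨F, hF⟩ := ContinuousMap.exists_restrict_eq hK
      (⟨K.domRestrict f, hf.domRestrict⟩ : C(K, ℝ))
    refine ⟨F, F.continuous, fun z hz => ?_⟩
    exact DFunLike.congr_fun hF ⟨z, hz⟩
  obtain ⟨F, hF, hF'⟩ := key (fun z => (g z).re) (Complex.continuous_re.comp_continuousOn hg)
  obtain ⟨G, hG, hG'⟩ := key (fun z => (g z).im) (Complex.continuous_im.comp_continuousOn hg)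
  refine ⟨fun z => F z + G z * Complex.I, by fun_prop, fun z hz => ?_⟩
  simp only [hF' z hz, hG' z hz, Complex.re_add_im]

lemma not_ns {K U : Set ℂ} (hK : IsCompact K) (hU : IsOpen U) (hUK : frontier U ⊆ K) {x y : ℂ}
    (hx : x ∈ U) (hy : y ∉ U) (hyK : y ∉ K) : ¬ NS K x y := by
  classical
  rintro ⟨g, hg, h⟩
  obtain ⟨G, hG, hGg⟩ := exists_ext hK.isClosed hg
  let φ : ℂ → ℂ := fun z => if z ∈ U then Complex.exp (G z) * (z - y) else z - x
  have hφ : Continuous φ := by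
    apply Continuous.if
    · intro a ha
      rw [hGg a (hUK ha), ← h a (hUK ha)]
    · fun_prop
    · fun_prop
  have hφ0 : ∀ z, φ z ≠ 0 := by
    intro z
    by_cases hz : z ∈ U
    · simp only [φ, hz, if_true]
      refine mul_ne_zero (Complex.exp_ne_zero _) (sub_ne_zero.2 ?_)
      rintro rfl; exact hy hz
    · simp only [φ, hz, if_false]
      refine (sub_ne_zero.2 ?_)
      rintro rfl; exact hz hx
  obtain ⟨ψ, hψ, hψφ⟩ := exists_log hφ hφ0
  obtain ⟨R₀, hR₀⟩ := hK.isBounded.subset_ball (0 : ℂ)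
  let R := max R₀ (max (‖x‖ + 1) (‖y‖ + 1))
  have hxR : ‖x‖ < R := lt_of_lt_of_le (by linarith) ((le_max_left _ _).trans (le_max_right _ _))
  have hyR : ‖y‖ < R := lt_of_lt_of_le (by linarith) ((le_max_right _ _).trans (le_max_right _ _))
  have hdis : Disjoint (Metric.sphere (0:ℂ) R) (frontier U) := by
    rw [Set.disjoint_left]
    intro z hz hz'
    have h1 := hR₀ (hUK hz')
    simp at hz h1
    have : R₀ ≤ R := le_max_left _ _
    linarith
  have hpre : IsPreconnected (Metric.sphere (0:ℂ) R) :=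
    isPreconnected_sphere (by simp [Complex.rank_real_complex]) _ _
  have hcl : IsPreconnected (Metric.sphere (0:ℂ) R) := hpre
  rcases (Metric.sphere (0:ℂ) R ∩ U).eq_empty_or_nonempty with h0 | h0
  · refine circle_no_log hxR hψ.continuousOn fun z hz => ?_
    have : z ∉ U := fun hzU => by
      have : z ∈ Metric.sphere (0:ℂ) R ∩ U := ⟨hz, hzU⟩
      simp [h0] at this
    rw [hψφ]; simp [φ, this]
  · have hsub : Metric.sphere (0:ℂ) R ⊆ U := by
      apply hpre.subset_of_closure_inter_subset hU h0
      rintro z ⟨hz, hz'⟩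
      by_contra hzU
      exact Set.disjoint_left.1 hdis hz' (by rw [hU.frontier_eq]; exact ⟨hz, hzU⟩)
    refine circle_no_log hyR (ψ := fun z => ψ z - G z) (by fun_prop) fun z hz => ?_
    rw [Complex.exp_sub, hψφ]; simp [φ, hsub hz, Complex.exp_ne_zero]

lemma frontier_preconnected {K U : Set ℂ} (hK : IsPreconnected K)
    (hUc : IsPreconnected U) (hUK : frontier U ⊆ K) (hd : Disjoint U K) :
    IsPreconnected (frontier U) := by
  classical
  rw [isPreconnected_closed_iff]
  intro t t' ht ht' hc ⟨a, ha, hat⟩ ⟨b, hb, hbt⟩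
  by_contra hne
  have hne : frontier U ∩ (t ∩ t') = ∅ := Set.not_nonempty_iff_eq_empty.1 hne
  obtain ⟨f, hf0, hf1, -⟩ := exists_continuous_zero_one_of_isClosed
    (s := frontier U ∩ t) (t := frontier U ∩ t') (isClosed_frontier.inter ht)
    (isClosed_frontier.inter ht') (by
      rw [Set.disjoint_left]
      rintro z ⟨hz, hz1⟩ ⟨_, hz2⟩
      have : z ∈ frontier U ∩ (t ∩ t') := ⟨hz, hz1, hz2⟩
      simp [hne] at this)
  let φ : ℂ → ℂ := fun z => if z ∈ U then Complex.exp (f z * (2 * Real.pi * Complex.I)) else 1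
  have hφ : Continuous φ := by
    apply Continuous.if
    · intro z hz
      rcases hc hz with h | h
      · rw [hf0 ⟨hz, h⟩]; simp
      · rw [hf1 ⟨hz, h⟩]; simp
    · fun_prop
    · fun_prop
  obtain ⟨ψ, hψ, hψφ⟩ := exists_log hφ (by
    intro z; simp only [φ]; split_ifs
    · exact Complex.exp_ne_zero _
    · simp)
  have hKc : ψ a - 0 = ψ b - 0 := exp_eq_const hK (h₂ := fun _ => 0) hψ.continuousOn
    continuousOn_const (by
      intro z hz
      rw [hψφ]
      have : z ∉ U := fun h => Set.disjoint_left.1 hd h hz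
      simp [φ, this]) (hUK ha) (hUK hb)
  have hcl := exp_eq_const hUc.closure (h₁ := ψ) (h₂ := fun z => f z * (2 * Real.pi * Complex.I))
    hψ.continuousOn (by fun_prop) (by
      have : closure U ⊆ {z | Complex.exp (ψ z) = Complex.exp (f z * (2 * Real.pi * Complex.I))} := by
        apply closure_minimal
        · intro z hz
          simp [hψφ, φ, hz]
        · exact isClosed_eq (by fun_prop) (by fun_prop)
      exact this) (frontier_subset_closure ha) (frontier_subset_closure hb)
  rw [hf0 ⟨ha, hat⟩, hf1 ⟨hb, hbt⟩] at hcl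
  have : ψ a = ψ b := by simpa using hKc
  rw [this] at hcl
  simp at hcl
  rw [eq_comm, sub_eq_self] at hcl
  simp [Real.pi_ne_zero] at hcl

/-- The circle of centre `p` and radius `ρ`. -/
noncomputable def cc (p : ℂ) (ρ : ℝ) (t : ℝ) : ℂ := p + ρ * Complex.exp (t * Complex.I)

lemma cc_cont (p : ℂ) (ρ : ℝ) : Continuous (cc p ρ) := by
  unfold cc; fun_prop

lemma cc_mem_sphere (p : ℂ) {ρ : ℝ} (hρ : 0 < ρ) (t : ℝ) : cc p ρ t ∈ Metric.sphere p ρ := by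
  simp [cc, dist_eq_norm, Complex.norm_exp_ofReal_mul_I, abs_of_pos hρ]

lemma cc_surj (p : ℂ) {ρ : ℝ} {z : ℂ} (hz : z ∈ Metric.sphere p ρ) : ∃ t, cc p ρ t = z := by
  refine ⟨(z - p).arg, ?_⟩
  have : ‖z - p‖ = ρ := by simpa [dist_eq_norm] using hz
  rw [cc, ← this, Complex.norm_mul_exp_arg_mul_I]; ring

lemma cc_periodic (p : ℂ) (ρ t : ℝ) : cc p ρ (t + 2 * Real.pi) = cc p ρ t := by
  have : ((t + 2 * Real.pi : ℝ) : ℂ) * Complex.I = t * Complex.I + 2 * Real.pi * Complex.I := by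
    push_cast; ring
  rw [cc, this, Complex.exp_add, Complex.exp_two_pi_mul_I, mul_one, cc]

lemma cc_inj {p : ℂ} {ρ : ℝ} (hρ : 0 < ρ) {u v : ℝ} (h : cc p ρ u = cc p ρ v)
    (huv : |u - v| < 2 * Real.pi) : u = v := by
  have h1 : Complex.exp (u * Complex.I) = Complex.exp (v * Complex.I) := by
    have : (ρ : ℂ) ≠ 0 := by exact_mod_cast hρ.ne'
    exact mul_left_cancel₀ this (add_left_cancel h)
  obtain ⟨n, hn⟩ := Complex.exp_eq_exp_iff_exists_int.1 h1
  have h2 : u = v + n * (2 * Real.pi) := by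
    have := congrArg Complex.im hn
    simpa using this
  have h3 : |(n : ℝ)| * (2 * Real.pi) < 2 * Real.pi := by
    rw [h2] at huv
    simpa [abs_mul, abs_of_pos Real.pi_pos] using huv
  have h4 : |(n : ℝ)| < 1 := by
    by_contra h
    push Not at h
    nlinarith [Real.pi_pos]
  have h5 : n = 0 := by
    have : |n| < 1 := by exact_mod_cast h4
    exact Int.abs_lt_one_iff.1 this
  rw [h2, h5]; simp

lemma cc_dist (p : ℂ) {ρ : ℝ} (hρ : 0 < ρ) (u v : ℝ) : dist (cc p ρ u) (cc p ρ v) ≤ ρ * |u - v| := by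
  have h : cc p ρ u - cc p ρ v =
      ρ * (Complex.exp (v * Complex.I) * (Complex.exp (Complex.I * ((u - v : ℝ) : ℂ)) - 1)) := by
    rw [mul_sub, ← Complex.exp_add, cc, cc]
    have : (v : ℂ) * Complex.I + Complex.I * ((u - v : ℝ) : ℂ) = u * Complex.I := by push_cast; ring
    rw [this]; ring
  rw [dist_eq_norm, h, norm_mul, norm_mul, Complex.norm_exp_ofReal_mul_I, one_mul,
    Complex.norm_real, Real.norm_of_nonneg hρ.le]
  gcongr
  exact Real.norm_exp_I_mul_ofReal_sub_one_le

lemma ns_arc {p : ℂ} {ρ : ℝ} (hρ : 0 < ρ) {a s : ℝ} (has : a ≤ s) (hs : s - a < 2 * Real.pi)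
    {x y : ℂ} (hx : x ∉ cc p ρ '' Icc a s) (hy : y ∉ cc p ρ '' Icc a s) :
    NS (cc p ρ '' Icc a s) x y := by
  let P : ℂ → ℂ := fun w => cc p ρ (projIcc a s has w.re)
  have hP : Continuous P :=
    (cc_cont p ρ).comp (continuous_subtype_val.comp (continuous_projIcc.comp Complex.continuous_re))
  have hPm : ∀ w, P w ∈ cc p ρ '' Icc a s := fun w => ⟨_, (projIcc a s has w.re).2, rfl⟩
  have hPx : ∀ w, P w - x ≠ 0 := fun w h => hx (by rw [← sub_eq_zero.1 h]; exact hPm w)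
  have hPy : ∀ w, P w - y ≠ 0 := fun w h => hy (by rw [← sub_eq_zero.1 h]; exact hPm w)
  obtain ⟨ψ, hψ, hψφ⟩ := exists_log (φ := fun w => (P w - x) / (P w - y))
    (Continuous.div (by fun_prop) (by fun_prop) hPy) (fun w => div_ne_zero (hPx w) (hPy w))
  let m := (a + s) / 2
  let q : ℂ → ℂ := fun z => (z - p) / (ρ * Complex.exp (m * Complex.I))
  have hρ' : (ρ : ℂ) ≠ 0 := by exact_mod_cast hρ.ne'
  have hq : ∀ t, q (cc p ρ t) = Complex.exp ((t - m : ℝ) * Complex.I) := by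
    intro t
    have : ((t - m : ℝ) : ℂ) * Complex.I = t * Complex.I - m * Complex.I := by push_cast; ring
    rw [this, Complex.exp_sub]
    simp only [q, cc]
    have := Complex.exp_ne_zero (m * Complex.I)
    field_simp
    ring
  have hlog : ∀ t ∈ Icc a s, Complex.log (q (cc p ρ t)) = (t - m : ℝ) * Complex.I := by
    intro t ht
    have := Real.pi_pos
    have ht1 := ht.1
    have ht2 := ht.2
    rw [hq, Complex.log_exp]
    · simp [m]; linarith
    · simp [m]; linarith
  have hsl : ∀ t ∈ Icc a s, q (cc p ρ t) ∈ Complex.slitPlane := by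
    intro t ht
    rw [Complex.mem_slitPlane_iff_arg]
    refine ⟨?_, by rw [hq]; exact Complex.exp_ne_zero _⟩
    rw [← Complex.log_im, hlog t ht]
    have ht1 := ht.1
    have ht2 := ht.2
    simp [m]
    intro h
    linarith
  refine ⟨fun z => ψ ((m : ℂ) + (Complex.log (q z)).im), ?_, ?_⟩
  · apply hψ.comp_continuousOn
    apply continuousOn_const.add
    apply Complex.continuous_ofReal.comp_continuousOn
    apply Complex.continuous_im.comp_continuousOn
    apply ContinuousOn.clog
    · apply Continuous.continuousOn; simp only [q]; fun_prop
    · rintro _ ⟨t, ht, rfl⟩; exact hsl t ht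
  · rintro _ ⟨t, ht, rfl⟩
    have h1 : P ((m : ℂ) + (Complex.log (q (cc p ρ t))).im) = cc p ρ t := by
      rw [hlog t ht]
      simp only [P]
      have : ((m : ℂ) + ((((t - m : ℝ) : ℂ) * Complex.I).im : ℂ)).re = t := by simp
      rw [this, projIcc_of_mem has ht]
    have h2 := hPy ((m : ℂ) + (Complex.log (q (cc p ρ t))).im)
    rw [hψφ]
    rw [h1] at h2 ⊢
    field_simp

/-- `[a,b]` parametrises a crosscut of the complement of `E`. -/
structure Gap (E : Set ℂ) (p : ℂ) (ρ a b : ℝ) : Prop where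
  hρ : 0 < ρ
  lt : a < b
  le : b ≤ a + 2 * Real.pi
  ha : cc p ρ a ∈ E
  hb : cc p ρ b ∈ E
  out : ∀ t ∈ Ioo a b, cc p ρ t ∉ E

lemma Gap.mem {E : Set ℂ} {p : ℂ} {ρ a b : ℝ} (h : Gap E p ρ a b) {t : ℝ} (ht : t ∈ Icc a b)
    (htE : cc p ρ t ∈ E) : t = a ∨ t = b := by
  by_contra hh
  push Not at hh
  exact h.out t ⟨lt_of_le_of_ne ht.1 hh.1.symm, lt_of_le_of_ne ht.2 hh.2⟩ htE

lemma arc_compact (p : ℂ) (ρ a b : ℝ) : IsCompact (cc p ρ '' Icc a b) :=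
  isCompact_Icc.image (cc_cont p ρ)

lemma arc_preconn (p : ℂ) (ρ a b : ℝ) : IsPreconnected (cc p ρ '' Icc a b) :=
  isPreconnected_Icc.image _ (cc_cont p ρ).continuousOn

lemma exists_gap {E : Set ℂ} (hE : IsCompact E) (hEc : IsPreconnected E) {p d d0 : ℂ} {ρ θ : ℝ}
    (hρ : 0 < ρ) (hθ : cc p ρ θ ∈ E) (hd : d ∈ Metric.ball p ρ) (hd0 : d0 ∉ Metric.closedBall p ρ)
    (hd0E : d0 ∉ E) (hns : NS E d d0) :
    ∃ a b, θ ≤ a ∧ b ≤ θ + 2 * Real.pi ∧ Gap E p ρ a b ∧ ¬ NS (E ∪ cc p ρ '' Icc a b) d d0 := by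
  by_contra hcon
  push Not at hcon
  have hS : NS (Metric.sphere p ρ) d p := by
    refine ns_of_preconnected Metric.isClosed_sphere (convex_ball p ρ).isPreconnected ?_ hd
      (Metric.mem_ball_self hρ)
    intro z hz hz'
    rw [Metric.mem_ball] at hz
    rw [Metric.mem_sphere] at hz'
    linarith
  obtain ⟨A₁, hA₁, e₁⟩ := hS
  obtain ⟨A₂, hA₂, e₂⟩ := log_ball hd0
  obtain ⟨g, hg, eg⟩ := hns
  have hsph := cc_mem_sphere p hρ
  let G : ℝ → ℂ := fun t => A₁ (cc p ρ t) - A₂ (cc p ρ t) + (Real.log ρ + t * Complex.I)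
  have hG : Continuous G := by
    refine (Continuous.sub ?_ ?_).add (by fun_prop)
    · exact hA₁.comp_continuous (cc_cont p ρ) hsph
    · exact hA₂.comp_continuous (cc_cont p ρ) fun t => Metric.sphere_subset_closedBall (hsph t)
  have eG : ∀ t, cc p ρ t - d = Complex.exp (G t) * (cc p ρ t - d0) := by
    intro t
    rw [e₁ _ (hsph t), e₂ _ (Metric.sphere_subset_closedBall (hsph t)), Complex.exp_add,
      Complex.exp_sub, Complex.exp_add, ← Complex.ofReal_exp, Real.exp_log hρ]
    have := Complex.exp_ne_zero (A₂ (cc p ρ t))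
    field_simp
    simp [cc]
  let Z : Set ℝ := {t | t ∈ Icc θ (θ + 2 * Real.pi) ∧ cc p ρ t ∈ E}
  have hZ : IsCompact Z := isCompact_Icc.inter_right (hE.isClosed.preimage (cc_cont p ρ))
  let k : ℝ → ℂ := fun t => G t - g (cc p ρ t)
  have hk : ContinuousOn k Z :=
    hG.continuousOn.sub (hg.comp (cc_cont p ρ).continuousOn fun t ht => ht.2)
  have ek : ∀ t ∈ Z, Complex.exp (k t) = 1 := by
    intro t ht
    have h1 := eg _ ht.2
    rw [eG t] at h1
    have h2 : Complex.exp (G t) = Complex.exp (g (cc p ρ t)) := by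
      refine mul_right_cancel₀ (sub_ne_zero.2 ?_) h1
      intro h; exact hd0E (h ▸ ht.2)
    rw [Complex.exp_sub, h2, div_self (Complex.exp_ne_zero _)]
  have gapk : ∀ a b, θ ≤ a → b ≤ θ + 2 * Real.pi → Gap E p ρ a b → k a = k b := by
    intro a b h1 h2 hgap
    obtain ⟨f, hf, ef⟩ := hcon a b h1 h2 hgap
    have q1 := exp_eq_const (isPreconnected_Icc (a := a) (b := b)) (h₁ := G)
      (h₂ := fun t => f (cc p ρ t)) hG.continuousOn
      (hf.comp (cc_cont p ρ).continuousOn fun t ht => Or.inr ⟨t, ht, rfl⟩)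
      (by
        intro t ht
        rcases eq_or_ne (cc p ρ t) d0 with h | h
        · exact absurd (h ▸ Metric.sphere_subset_closedBall (hsph t)) hd0
        · exact mul_right_cancel₀ (sub_ne_zero.2 h)
            ((eG t).symm.trans (ef _ (Or.inr ⟨t, ht, rfl⟩))))
      (left_mem_Icc.2 hgap.lt.le) (right_mem_Icc.2 hgap.lt.le)
    have q2 := exp_eq_const hEc (h₁ := g) (h₂ := f) hg (hf.mono subset_union_left)
      (by
        intro z hz
        refine mul_right_cancel₀ (sub_ne_zero.2 ?_) ((eg z hz).symm.trans (ef z (Or.inl hz)))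
        intro h; exact hd0E (h ▸ hz))
      hgap.ha hgap.hb
    simp only [k]
    linear_combination q1 - q2
  have hθZ : θ ∈ Z := ⟨⟨le_rfl, by linarith [Real.pi_pos]⟩, hθ⟩
  have hθZ' : θ + 2 * Real.pi ∈ Z :=
    ⟨⟨by linarith [Real.pi_pos], le_rfl⟩, by rw [cc_periodic]; exact hθ⟩
  have hkne : k (θ + 2 * Real.pi) ≠ k θ := by
    intro h
    simp only [k, G, cc_periodic] at h
    have : (2 * Real.pi * Complex.I : ℂ) = 0 := by
      push_cast at h
      linear_combination h
    simp [Real.pi_ne_zero] at this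
  -- split Z
  let Z₁ : Set ℝ := {t | t ∈ Z ∧ k t = k θ}
  let Z₂ : Set ℝ := {t | t ∈ Z ∧ 1 ≤ ‖k t - k θ‖}
  have hZ₁ : IsCompact Z₁ :=
    hZ.of_isClosed_subset (hk.preimage_isClosed_of_isClosed hZ.isClosed isClosed_singleton)
      (fun t ht => ht.1)
  have hZ₂ : IsCompact Z₂ :=
    hZ.of_isClosed_subset ((hk.sub continuousOn_const).norm.preimage_isClosed_of_isClosed
      hZ.isClosed isClosed_Ici) (fun t ht => ht.1)
  have hsplit : ∀ t ∈ Z, t ∉ Z₁ → t ∈ Z₂ := by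
    intro t ht ht1
    refine ⟨ht, ?_⟩
    have hne : k t - k θ ≠ 0 := fun h => ht1 ⟨ht, sub_eq_zero.1 h⟩
    have h1 : Complex.exp (k t - k θ) = 1 := by rw [Complex.exp_sub, ek t ht, ek θ hθZ]; simp
    obtain ⟨n, hn⟩ := Complex.exp_eq_one_iff.1 h1
    have hn0 : n ≠ 0 := by rintro rfl; simp at hn; exact hne hn
    have h2 : (1 : ℝ) ≤ |(n : ℝ)| := by exact_mod_cast Int.one_le_abs hn0
    rw [hn]
    have h3 : ‖(n : ℂ) * (2 * Real.pi * Complex.I)‖ = |(n : ℝ)| * (2 * Real.pi) := by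
      simp [abs_of_pos Real.pi_pos]
    rw [h3]
    nlinarith [Real.pi_gt_three]
  have hdisj : ∀ t ∈ Z₁, t ∉ Z₂ := by
    rintro t ⟨_, h1⟩ ⟨_, h2⟩
    rw [h1] at h2; simp at h2; linarith
  have hend : θ + 2 * Real.pi ∈ Z₂ := hsplit _ hθZ' fun h => hkne h.2
  obtain ⟨b, hb, hbmin⟩ := hZ₂.exists_isLeast ⟨_, hend⟩
  obtain ⟨a, ha, hamax⟩ := (hZ₁.inter_right (isClosed_Iic (a := b))).exists_isGreatest
    ⟨θ, ⟨hθZ, rfl⟩, hb.1.1.1⟩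
  have hab : a < b := lt_of_le_of_ne ha.2 (fun h => hdisj a ha.1 (h ▸ hb))
  have hgap : Gap E p ρ a b :=
    { hρ := hρ
      lt := hab
      le := by have := hb.1.1.2; have := ha.1.1.1.1; linarith
      ha := ha.1.1.2
      hb := hb.1.2
      out := by
        intro t ht htE
        have htZ : t ∈ Z := ⟨⟨ha.1.1.1.1.trans ht.1.le, ht.2.le.trans hb.1.1.2⟩, htE⟩
        by_cases h1 : t ∈ Z₁
        · exact absurd (hamax ⟨h1, ht.2.le⟩) (not_le.2 ht.1)
        · exact absurd (hbmin (hsplit t htZ h1)) (not_le.2 ht.2) }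
  have := gapk a b ha.1.1.1.1 hb.1.1.2 hgap
  rw [ha.1.2] at this
  exact hdisj b ⟨hb.1, this.symm⟩ hb

lemma ns_crosscut {E L : Set ℂ} (hE : IsClosed E) {p x y c : ℂ} {ρ a b r : ℝ}
    (hgap : Gap E p ρ a b) (hL : IsClosed L) (hLc : IsPreconnected L) (hLE : L ⊆ E)
    (haL : cc p ρ a ∈ L) (hbL : cc p ρ b ∈ L) (hLb : L ⊆ Metric.closedBall c r)
    (hI : cc p ρ '' Icc a b ⊆ Metric.closedBall c r) (hx : x ∉ Metric.closedBall c r)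
    (hy : y ∉ Metric.closedBall c r) (hyE : y ∉ E) (hns : NS E x y) :
    NS (E ∪ cc p ρ '' Icc a b) x y := by
  have h1 : NS (cc p ρ '' Icc a b ∪ L) x y := (ns_ball hx hy).mono (union_subset hI hLb)
  have h2 : E ∩ (cc p ρ '' Icc a b ∪ L) = L := by
    ext z
    constructor
    · rintro ⟨hz, ⟨t, ht, rfl⟩ | hz'⟩
      · rcases hgap.mem ht hz with rfl | rfl
        · exact haL
        · exact hbL
      · exact hz'
    · intro hz
      exact ⟨hLE hz, Or.inr hz⟩
  refine (ns_glue hE ((arc_compact p ρ a b).isClosed.union hL) (by rw [h2]; exact hLc)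
    (fun h => hyE h.1) hns h1).mono ?_
  exact union_subset_union_right _ subset_union_left

lemma ns_glue_sub {A B : Set ℂ} (hA : IsClosed A) (hB : IsClosed B) {e : ℂ} (hAB : A ∩ B ⊆ {e})
    {x y : ℂ} (hy : y ∉ A) (h : NS A x y) (h' : NS B x y) : NS (A ∪ B) x y :=
  ns_glue hA hB (Set.subsingleton_singleton.anti hAB).isPreconnected (fun h => hy h.1) h h'

lemma gap_component {E : Set ℂ} (hE : IsCompact E) (hEc : IsPreconnected E) {p x y : ℂ}
    {ρ a b : ℝ} (hgap : Gap E p ρ a b) {U : Set ℂ} (hU : IsOpen U) (hUc : IsPreconnected U)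
    (hdis : Disjoint U (E ∪ cc p ρ '' Icc a b)) (hfr : frontier U ⊆ E ∪ cc p ρ '' Icc a b)
    (hx : x ∈ U) (hy : y ∉ U) (hyK : y ∉ E ∪ cc p ρ '' Icc a b) (hns : NS E x y) :
    (∀ t ∈ Ioo a b, cc p ρ t ∈ closure U) ∧ IsPreconnected (closure U ∩ E) := by
  have hxK : x ∉ E ∪ cc p ρ '' Icc a b := fun h => Set.disjoint_left.1 hdis hx h
  have hclos : closure U ⊆ U ∪ frontier U := by
    rw [closure_eq_self_union_frontier]
  have sub1 : ∀ {s s'}, a ≤ s → s' ≤ b → cc p ρ '' Icc s s' ⊆ cc p ρ '' Icc a b :=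
    fun h h' => image_mono (Icc_subset_Icc h h')
  have part1 : ∀ t ∈ Ioo a b, cc p ρ t ∈ closure U := by
    intro t ht
    by_contra hcon
    have hopen : IsOpen (cc p ρ ⁻¹' (closure U)ᶜ ∩ Ioo a b) :=
      (isClosed_closure.isOpen_compl.preimage (cc_cont p ρ)).inter isOpen_Ioo
    obtain ⟨ε, hε, hball⟩ := Metric.isOpen_iff.1 hopen t ⟨hcon, ht⟩
    let s := t - ε / 2
    let s' := t + ε / 2
    have hmem : ∀ u, s ≤ u → u ≤ s' → u ∈ cc p ρ ⁻¹' (closure U)ᶜ ∩ Ioo a b := by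
      intro u hu hu'
      apply hball
      rw [Metric.mem_ball, Real.dist_eq, abs_lt]
      constructor <;> simp only [s, s'] at hu hu' <;> linarith
    have hss : s < s' := by simp only [s, s']; linarith
    have hs := (hmem s le_rfl hss.le).2
    have hs' := (hmem s' hss.le le_rfl).2
    have hle := hgap.le
    have c1 := (arc_compact p ρ a s).isClosed
    have c2 := (arc_compact p ρ s' b).isClosed
    have i1 : cc p ρ '' Icc a s ⊆ cc p ρ '' Icc a b := sub1 le_rfl hs.2.le
    have i2 : cc p ρ '' Icc s' b ⊆ cc p ρ '' Icc a b := sub1 hs'.1.le le_rfl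
    have n1 : NS (E ∪ cc p ρ '' Icc a s) x y := by
      refine ns_glue_sub hE.isClosed c1 (e := cc p ρ a) ?_ (fun h => hyK (Or.inl h)) hns
        (ns_arc hgap.hρ hs.1.le (by linarith [hs.2]) (fun h => hxK (Or.inr (i1 h)))
          (fun h => hyK (Or.inr (i1 h))))
      rintro _ ⟨hzE, u, hu, rfl⟩
      rcases hgap.mem ⟨hu.1, hu.2.trans hs.2.le⟩ hzE with h | h
      · rw [h]; rfl
      · exact absurd hu.2 (by rw [h]; exact not_le.2 hs.2)
    have n2 : NS (E ∪ cc p ρ '' Icc s' b) x y := by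
      refine ns_glue_sub hE.isClosed c2 (e := cc p ρ b) ?_ (fun h => hyK (Or.inl h)) hns
        (ns_arc hgap.hρ hs'.2.le (by linarith [hs'.1]) (fun h => hxK (Or.inr (i2 h)))
          (fun h => hyK (Or.inr (i2 h))))
      rintro _ ⟨hzE, u, hu, rfl⟩
      rcases hgap.mem ⟨hs'.1.le.trans hu.1, hu.2⟩ hzE with h | h
      · exact absurd hu.1 (by rw [h]; exact not_le.2 hs'.1)
      · rw [h]; rfl
    have hEint : (E ∪ cc p ρ '' Icc a s) ∩ (E ∪ cc p ρ '' Icc s' b) = E := by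
      refine Subset.antisymm ?_ (fun z hz => ⟨Or.inl hz, Or.inl hz⟩)
      rintro z ⟨hz | ⟨u, hu, rfl⟩, hz' | ⟨v, hv, hvz⟩⟩
      · exact hz
      · exact hz
      · exact hz'
      · rcases eq_or_ne u a with rfl | hne
        · exact hgap.ha
        · have hua : a < u := lt_of_le_of_ne hu.1 hne.symm
          have h1 := hu.2
          have h2 := hv.1
          have h3 := hv.2
          have := cc_inj hgap.hρ hvz (by rw [abs_lt]; constructor <;> linarith)
          linarith
    have n3 := ns_glue (hE.isClosed.union c1) (hE.isClosed.union c2) (by rw [hEint]; exact hEc)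
      (fun h => hyK (Or.inl (by rwa [hEint] at h))) n1 n2
    refine not_ns ((hE.union (arc_compact p ρ a s)).union (hE.union (arc_compact p ρ s' b))) hU ?_ hx hy ?_ n3
    · intro z hz
      rcases hfr hz with h | ⟨u, hu, rfl⟩
      · exact Or.inl (Or.inl h)
      · rcases le_total u s with h1 | h1
        · exact Or.inl (Or.inr ⟨u, ⟨hu.1, h1⟩, rfl⟩)
        · rcases le_total s' u with h2 | h2
          · exact Or.inr (Or.inr ⟨u, ⟨h2, hu.2⟩, rfl⟩)
          · exact absurd (frontier_subset_closure hz) (hmem u h1 h2).1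
    · rintro ((h | h) | (h | h))
      · exact hyK (Or.inl h)
      · exact hyK (Or.inr (i1 h))
      · exact hyK (Or.inl h)
      · exact hyK (Or.inr (i2 h))
  refine ⟨part1, ?_⟩
  have hIcl : ∀ t ∈ Icc a b, cc p ρ t ∈ closure U := by
    have h1 : closure (Ioo a b) ⊆ cc p ρ ⁻¹' closure U :=
      closure_minimal part1 (isClosed_closure.preimage (cc_cont p ρ))
    rw [closure_Ioo hgap.lt.ne] at h1
    exact h1
  have hca : cc p ρ a ∈ closure U ∩ E := ⟨hIcl a (left_mem_Icc.2 hgap.lt.le), hgap.ha⟩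
  have hcb : cc p ρ b ∈ closure U ∩ E := ⟨hIcl b (right_mem_Icc.2 hgap.lt.le), hgap.hb⟩
  have hKc : IsPreconnected (E ∪ cc p ρ '' Icc a b) :=
    IsPreconnected.union (cc p ρ a) hgap.ha ⟨a, left_mem_Icc.2 hgap.lt.le, rfl⟩ hEc
      (arc_preconn p ρ a b)
  have hfrc := frontier_preconnected hKc hUc hfr hdis
  have hFfr : closure U ∩ E ⊆ frontier U := by
    rintro z ⟨hz, hzE⟩
    rw [hU.frontier_eq]
    exact ⟨hz, fun h => Set.disjoint_left.1 hdis h (Or.inl hzE)⟩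
  -- general facts about a splitting
  have key : ∀ F₁ F₂ : Set ℂ, IsClosed F₁ → IsClosed F₂ → closure U ∩ E ⊆ F₁ ∪ F₂ →
      closure U ∩ E ∩ (F₁ ∩ F₂) = ∅ → cc p ρ a ∈ F₁ → (closure U ∩ E ∩ F₂).Nonempty → False := by
    intro F₁ F₂ h₁ h₂ hcov hemp ha₁ ⟨w, hw, hw₂⟩
    have hFcl : IsClosed (closure U ∩ E) := isClosed_closure.inter hE.isClosed
    have g1 : IsCompact (closure U ∩ E ∩ F₁) :=
      (hE.inter_left isClosed_closure).inter_right h₁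
    have g2 : IsCompact (closure U ∩ E ∩ F₂) :=
      (hE.inter_left isClosed_closure).inter_right h₂
    have ha₂ : cc p ρ a ∉ F₂ := fun h => by
      have : cc p ρ a ∈ closure U ∩ E ∩ (F₁ ∩ F₂) := ⟨hca, ha₁, h⟩
      simp [hemp] at this
    have hcovfr : frontier U ⊆ (closure U ∩ E ∩ F₁ ∪ cc p ρ '' Icc a b) ∪ closure U ∩ E ∩ F₂ := by
      intro z hz
      rcases hfr hz with h | h
      · have hzF : z ∈ closure U ∩ E := ⟨frontier_subset_closure hz, h⟩
        rcases hcov hzF with h' | h'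
        · exact Or.inl (Or.inl ⟨hzF, h'⟩)
        · exact Or.inr ⟨hzF, h'⟩
      · exact Or.inl (Or.inr h)
    by_cases hb₂ : cc p ρ b ∈ F₂
    · have hb₁ : cc p ρ b ∉ F₁ := fun h => by
        have : cc p ρ b ∈ closure U ∩ E ∩ (F₁ ∩ F₂) := ⟨hcb, h, hb₂⟩
        simp [hemp] at this
      have hlt : b - a < 2 * Real.pi := by
        rcases lt_or_eq_of_le hgap.le with h | h
        · linarith
        · exfalso
          rw [h, cc_periodic] at hb₁
          exact hb₁ ha₁
      have n1 : NS (closure U ∩ E ∩ F₁ ∪ cc p ρ '' Icc a b) x y := by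
        refine ns_glue_sub g1.isClosed (arc_compact p ρ a b).isClosed (e := cc p ρ a) ?_
          (fun h => hyK (Or.inl h.1.2)) (hns.mono fun z hz => hz.1.2)
          (ns_arc hgap.hρ hgap.lt.le hlt (fun h => hxK (Or.inr h)) (fun h => hyK (Or.inr h)))
        rintro _ ⟨⟨hz, hz₁⟩, t, ht, rfl⟩
        rcases hgap.mem ht hz.2 with rfl | rfl
        · rfl
        · exact absurd hz₁ hb₁
      have n2 : NS ((closure U ∩ E ∩ F₁ ∪ cc p ρ '' Icc a b) ∪ closure U ∩ E ∩ F₂) x y := by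
        refine ns_glue_sub (g1.union (arc_compact p ρ a b)).isClosed g2.isClosed (e := cc p ρ b) ?_
          (fun h => hyK (h.imp (fun h => h.1.2) id)) n1 (hns.mono fun z hz => hz.1.2)
        rintro z ⟨hz | ⟨t, ht, rfl⟩, hz'⟩
        · have : z ∈ closure U ∩ E ∩ (F₁ ∩ F₂) := ⟨hz.1, hz.2, hz'.2⟩
          simp [hemp] at this
        · rcases hgap.mem ht hz'.1.2 with rfl | rfl
          · exact absurd hz'.2 ha₂
          · rfl
      refine not_ns ((g1.union (arc_compact p ρ a b)).union g2) hU hcovfr hx hy ?_ n2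
      rintro ((h | h) | h)
      · exact hyK (Or.inl h.1.2)
      · exact hyK (Or.inr h)
      · exact hyK (Or.inl h.1.2)
    · rw [isPreconnected_closed_iff] at hfrc
      obtain ⟨z, hz, hz1, hz2⟩ := hfrc _ _ (g1.union (arc_compact p ρ a b)).isClosed g2.isClosed
        hcovfr ⟨_, hFfr hca, Or.inl ⟨hca, ha₁⟩⟩ ⟨w, hFfr hw, hw, hw₂⟩
      rcases hz1 with h | ⟨t, ht, rfl⟩
      · have : z ∈ closure U ∩ E ∩ (F₁ ∩ F₂) := ⟨h.1, h.2, hz2.2⟩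
        simp [hemp] at this
      · rcases hgap.mem ht hz2.1.2 with rfl | rfl
        · exact ha₂ hz2.2
        · exact hb₂ hz2.2
  rw [isPreconnected_closed_iff]
  intro F₁ F₂ h₁ h₂ hcov n₁ n₂
  by_contra hne
  have hne := Set.not_nonempty_iff_eq_empty.1 hne
  rcases hcov hca with h | h
  · exact key F₁ F₂ h₁ h₂ hcov hne h n₂
  · exact key F₂ F₁ h₂ h₁ (by rwa [union_comm]) (by rwa [inter_comm F₂ F₁]) h n₁

lemma comp_frontier {F : Set ℂ} (hF : IsOpen F) (x : ℂ) :
    frontier (connectedComponentIn F x) ⊆ Fᶜ := by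
  intro z hz hzF
  have ho : IsOpen (connectedComponentIn F x) := hF.connectedComponentIn
  rw [ho.frontier_eq] at hz
  obtain ⟨w, hw, hw'⟩ := mem_closure_iff.1 hz.1 _ (hF.connectedComponentIn (x := z))
    (mem_connectedComponentIn hzF)
  apply hz.2
  rw [connectedComponentIn_eq hw', ← connectedComponentIn_eq hw]
  exact mem_connectedComponentIn hzF

lemma gap_sides {E : Set ℂ} (hE : IsClosed E) {p : ℂ} {ρ a b : ℝ} (hgap : Gap E p ρ a b) :
    ∃ h₁ h₂ : ℂ, ∀ d, d ∉ E ∪ cc p ρ '' Icc a b →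
      (∀ t ∈ Ioo a b, cc p ρ t ∈ closure (connectedComponentIn (E ∪ cc p ρ '' Icc a b)ᶜ d)) →
      connectedComponentIn (E ∪ cc p ρ '' Icc a b)ᶜ d =
        connectedComponentIn (E ∪ cc p ρ '' Icc a b)ᶜ h₁ ∨
      connectedComponentIn (E ∪ cc p ρ '' Icc a b)ᶜ d =
        connectedComponentIn (E ∪ cc p ρ '' Icc a b)ᶜ h₂ := by
  have hρ := hgap.hρ
  set F := (E ∪ cc p ρ '' Icc a b)ᶜ with hF
  let t := (a + b) / 2
  have ht : t ∈ Ioo a b := by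
    have := hgap.lt
    constructor <;> simp only [t] <;> linarith
  let e : ℂ → ℂ := fun w => p + Complex.exp w
  have he : Continuous e := by simp only [e]; fun_prop
  let w₀ : ℂ := Real.log ρ + t * Complex.I
  have hecc : ∀ w : ℂ, w.re = Real.log ρ → e w = cc p ρ w.im := by
    intro w hw
    have : w = Real.log ρ + w.im * Complex.I := by
      rw [← hw, Complex.re_add_im]
    simp only [e, cc]
    conv_lhs => rw [this]
    rw [Complex.exp_add, ← Complex.ofReal_exp, Real.exp_log hρ]
  have hsph : ∀ w : ℂ, ∀ u : ℝ, e w = cc p ρ u → w.re = Real.log ρ := by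
    intro w u h
    have h1 : ‖Complex.exp w‖ = ρ := by
      have := cc_mem_sphere p hρ u
      rw [← h] at this
      simpa [e, dist_eq_norm] using this
    rw [Complex.norm_exp] at h1
    rw [← h1, Real.log_exp]
  have hw₀re : w₀.re = Real.log ρ := by simp [w₀]
  have hw₀im : w₀.im = t := by simp [w₀]
  have hw₀ : e w₀ = cc p ρ t := by rw [hecc w₀ hw₀re, hw₀im]
  have hopen : IsOpen (e ⁻¹' Eᶜ ∩ Complex.im ⁻¹' Ioo a b) :=
    (hE.isOpen_compl.preimage he).inter (isOpen_Ioo.preimage Complex.continuous_im)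
  obtain ⟨η, hη, hball⟩ := Metric.isOpen_iff.1 hopen w₀
    ⟨by rw [mem_preimage, hw₀]; exact hgap.out t ht, by rw [mem_preimage, hw₀im]; exact ht⟩
  have hNopen : IsOpen (e '' Metric.ball w₀ η) := by
    have : IsOpenMap e := (isOpenMap_add_left p).comp Complex.isOpenMap_exp
    exact this _ Metric.isOpen_ball
  have hside : ∀ S : Set ℂ, Convex ℝ S → S ⊆ Metric.ball w₀ η → (∀ w ∈ S, w.re ≠ Real.log ρ) →
      ∀ h ∈ S, ∀ w ∈ S, ∀ d, e w ∈ connectedComponentIn F d →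
      connectedComponentIn F d = connectedComponentIn F (e h) := by
    intro S hS hSb hSre h hh w hw d hwd
    have h1 : e '' S ⊆ F := by
      rintro _ ⟨v, hv, rfl⟩ (hvE | ⟨u, _, hu⟩)
      · exact (hball (hSb hv)).1 hvE
      · exact hSre v hv (hsph v u hu.symm)
    have h2 : IsPreconnected (e '' S) := hS.isPreconnected.image _ he.continuousOn
    rw [connectedComponentIn_eq hwd]
    have h3 := h2.subset_connectedComponentIn (mem_image_of_mem e hw) h1
    exact connectedComponentIn_eq (h3 (mem_image_of_mem e hh))
  let s₁ : ℂ := w₀ + ((η / 2 : ℝ) : ℂ)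
  let s₂ : ℂ := w₀ - ((η / 2 : ℝ) : ℂ)
  refine ⟨e s₁, e s₂, fun d hd hcl => ?_⟩
  obtain ⟨z, ⟨w, hw, rfl⟩, hzU⟩ := mem_closure_iff.1 (hcl t ht) _ hNopen
    ⟨w₀, Metric.mem_ball_self hη, hw₀⟩
  have hη2 : |η / 2| < η := by rw [abs_of_pos (by linarith)]; linarith
  rcases lt_trichotomy w.re (Real.log ρ) with h | h | h
  · right
    refine hside (Metric.ball w₀ η ∩ {w | w.re < Real.log ρ})
      ((convex_ball _ _).inter (convex_halfSpace_re_lt _)) inter_subset_left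
      (fun w hw => ne_of_lt hw.2) s₂ ⟨?_, ?_⟩ w ⟨hw, h⟩ d hzU
    · simp only [s₂, Metric.mem_ball, dist_eq_norm]
      rw [sub_sub_cancel_left, norm_neg, Complex.norm_real, Real.norm_eq_abs]
      exact hη2
    · simp only [s₂, mem_ofPred_eq, Complex.sub_re, hw₀re, Complex.ofReal_re]; linarith
  · exfalso
    have h1 := connectedComponentIn_subset _ _ hzU
    apply h1
    right
    exact ⟨w.im, Ioo_subset_Icc_self (hball hw).2, (hecc w h).symm⟩
  · left
    refine hside (Metric.ball w₀ η ∩ {w | Real.log ρ < w.re})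
      ((convex_ball _ _).inter (convex_halfSpace_re_gt _)) inter_subset_left
      (fun w hw => ne_of_gt hw.2) s₁ ⟨?_, ?_⟩ w ⟨hw, h⟩ d hzU
    · simp only [s₁, Metric.mem_ball, dist_eq_norm]
      rw [add_sub_cancel_left, Complex.norm_real, Real.norm_eq_abs]
      exact hη2
    · simp only [s₁, mem_ofPred_eq, Complex.add_re, hw₀re, Complex.ofReal_re]; linarith

lemma gaps_finite {E : Set ℂ} {p : ℂ} {ρ θ η : ℝ} (hη : 0 < η) :
    {ab : ℝ × ℝ | θ ≤ ab.1 ∧ ab.2 ≤ θ + 2 * Real.pi ∧ Gap E p ρ ab.1 ab.2 ∧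
      η ≤ ab.2 - ab.1}.Finite := by
  refine Set.Finite.of_finite_image (f := fun ab : ℝ × ℝ => ⌊ab.1 / η⌋)
    ((Set.finite_Icc ⌊θ / η⌋ ⌊(θ + 2 * Real.pi) / η⌋).subset ?_) ?_
  · rintro _ ⟨⟨a, b⟩, ⟨h1, h2, h3, h4⟩, rfl⟩
    have := h3.lt
    simp only at *
    exact ⟨Int.floor_mono (by gcongr), Int.floor_mono (by gcongr; linarith)⟩
  · have aux : ∀ a b a' b', Gap E p ρ a b → Gap E p ρ a' b' → η ≤ b - a →
        ⌊a / η⌋ = ⌊a' / η⌋ → ¬ a < a' := by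
      intro a b a' b' g g' hab hfl hlt
      have h1 : b ≤ a' := by
        by_contra h
        exact g.out a' ⟨hlt, not_le.1 h⟩ g'.ha
      have h2 : a / η + 1 ≤ a' / η := by
        rw [div_add_one hη.ne']
        gcongr
        linarith
      have h3 := Int.floor_mono h2
      rw [Int.floor_add_one] at h3
      omega
    rintro ⟨a, b⟩ ⟨_, _, g, h⟩ ⟨a', b'⟩ ⟨_, _, g', h'⟩ hfl
    simp only at g h g' h' hfl
    have haa : a = a' := le_antisymm (not_lt.1 (aux a' b' a b g' g h' hfl.symm))
      (not_lt.1 (aux a b a' b' g g' h hfl))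
    subst haa
    have hbb : b = b' := by
      rcases lt_trichotomy b b' with h | h | h
      · exact absurd g.hb (g'.out b ⟨g.lt, h⟩)
      · exact h
      · exact absurd g'.hb (g.out b' ⟨g'.lt, h⟩)
    rw [hbb]

lemma uLC {γ : ℝ → ℂ} (hγ : ContinuousOn γ (Icc 0 1)) {ε : ℝ} (hε : 0 < ε) :
    ∃ δ > 0, ∀ e ∈ γ '' Icc 0 1, ∀ e' ∈ γ '' Icc 0 1, dist e e' < δ →
      ∃ L ⊆ γ '' Icc 0 1, IsClosed L ∧ IsPreconnected L ∧ e ∈ L ∧ e' ∈ L ∧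
        L ⊆ Metric.closedBall e ε := by
  have huc := isCompact_Icc.uniformContinuousOn_of_continuous hγ
  rw [Metric.uniformContinuousOn_iff] at huc
  obtain ⟨τ, hτ, huc⟩ := huc (ε / 3) (by linarith)
  let Z : Set (ℝ × ℝ) := {st | st ∈ Icc (0:ℝ) 1 ×ˢ Icc (0:ℝ) 1 ∧ γ st.1 = γ st.2}
  let C : Set (ℝ × ℝ) := (Icc (0:ℝ) 1 ×ˢ Icc (0:ℝ) 1) \ Metric.thickening τ Z
  have hC : IsCompact C := (isCompact_Icc.prod isCompact_Icc).diff Metric.isOpen_thickening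
  have hf : ContinuousOn (fun st : ℝ × ℝ => dist (γ st.1) (γ st.2)) C := by
    refine continuous_dist.comp_continuousOn (ContinuousOn.prodMk ?_ ?_)
    · exact hγ.comp continuousOn_fst (fun z hz => hz.1.1)
    · exact hγ.comp continuousOn_snd (fun z hz => hz.1.2)
  have hmin : ∃ δ > 0, ∀ st ∈ C, δ ≤ dist (γ st.1) (γ st.2) := by
    rcases C.eq_empty_or_nonempty with h | h
    · exact ⟨1, one_pos, fun st hst => by simp [h] at hst⟩
    · obtain ⟨z, hz, hzm⟩ := hC.exists_isMinOn h hf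
      refine ⟨dist (γ z.1) (γ z.2), ?_, fun st hst => hzm hst⟩
      rw [gt_iff_lt, dist_pos]
      intro heq
      exact hz.2 (Metric.self_subset_thickening hτ _ ⟨hz.1, heq⟩)
  obtain ⟨δ, hδ, hmin⟩ := hmin
  refine ⟨δ, hδ, ?_⟩
  rintro _ ⟨s, hs, rfl⟩ _ ⟨t, ht, rfl⟩ hst
  have h1 : (s, t) ∈ Metric.thickening τ Z := by
    by_contra h
    exact absurd (hmin (s, t) ⟨⟨hs, ht⟩, h⟩) (not_le.2 hst)
  rw [Metric.mem_thickening_iff] at h1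
  obtain ⟨⟨s', t'⟩, ⟨⟨hs', ht'⟩, heq⟩, hd⟩ := h1
  simp only at hs' ht' heq
  rw [Prod.dist_eq, max_lt_iff] at hd
  obtain ⟨hd1, hd2⟩ := hd
  simp only [Real.dist_eq] at hd1 hd2
  have ss : uIcc s s' ⊆ Icc 0 1 := Set.ordConnected_Icc.uIcc_subset hs hs'
  have tt : uIcc t' t ⊆ Icc 0 1 := Set.ordConnected_Icc.uIcc_subset ht' ht
  refine ⟨γ '' uIcc s s' ∪ γ '' uIcc t' t, union_subset (image_mono ss) (image_mono tt), ?_, ?_,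
    Or.inl ⟨s, left_mem_uIcc, rfl⟩, Or.inr ⟨t, right_mem_uIcc, rfl⟩, ?_⟩
  · exact (isCompact_uIcc.image_of_continuousOn (hγ.mono ss)).isClosed.union
      (isCompact_uIcc.image_of_continuousOn (hγ.mono tt)).isClosed
  · exact IsPreconnected.union (γ s') ⟨s', right_mem_uIcc, rfl⟩ ⟨t', left_mem_uIcc, heq.symm⟩
      (isPreconnected_uIcc.image _ (hγ.mono ss)) (isPreconnected_uIcc.image _ (hγ.mono tt))
  · rintro _ (⟨u, hu, rfl⟩ | ⟨u, hu, rfl⟩)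
    · have h2 : dist u s < τ := by
        rw [Real.dist_eq]
        have := abs_sub_left_of_mem_uIcc hu
        rw [abs_sub_comm s s'] at hd1
        linarith
      have := huc u (ss hu) s hs h2
      rw [Metric.mem_closedBall]
      linarith
    · have h2 : dist u t' < τ := by
        rw [Real.dist_eq]
        have := abs_sub_left_of_mem_uIcc hu
        linarith
      have h3 := huc u (tt hu) t' ht' h2
      have h4 := huc s' hs' s hs (by rw [Real.dist_eq, abs_sub_comm]; exact hd1)
      have h5 := dist_triangle (γ u) (γ t') (γ s)
      rw [← heq] at h3 h5
      rw [Metric.mem_closedBall]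
      linarith

lemma core {γ : ℝ → ℂ} (hγ : ContinuousOn γ (Icc 0 1)) {x : ℂ} (hx : x ∉ γ '' Icc 0 1) {p : ℂ}
    (hp : p ∈ frontier (connectedComponentIn (γ '' Icc 0 1)ᶜ x)) {ε : ℝ} (hε : 0 < ε)
    (hεx : ε < dist x p) {q : ℂ} (hq : q ∈ γ '' Icc 0 1) (hqp : q ≠ p) :
    ∃ V ⊆ frontier (connectedComponentIn (γ '' Icc 0 1)ᶜ x), V ⊆ Metric.closedBall p ε ∧
      IsPreconnected V ∧ ∃ r > 0,
        frontier (connectedComponentIn (γ '' Icc 0 1)ᶜ x) ∩ Metric.ball p r ⊆ V := by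
  obtain ⟨δ, hδ, hLC⟩ := uLC hγ (half_pos hε)
  have hE : IsCompact (γ '' Icc 0 1) := isCompact_Icc.image_of_continuousOn hγ
  have hEc : IsPreconnected (γ '' Icc 0 1) := isPreconnected_Icc.image _ hγ
  have hLC1 := fun {r : ℝ} (hr : 0 < r) => uLC hγ hr
  generalize γ '' Icc 0 1 = E at *
  set D := connectedComponentIn Eᶜ x with hD
  have hEo : IsOpen Eᶜ := hE.isClosed.isOpen_compl
  have hDo : IsOpen D := hEo.connectedComponentIn
  have hxD : x ∈ D := mem_connectedComponentIn hx
  have hDE : D ⊆ Eᶜ := connectedComponentIn_subset _ _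
  have hDc : IsPreconnected D := isPreconnected_connectedComponentIn
  have hfrD : frontier D ⊆ E := by
    have := comp_frontier hEo x
    rwa [compl_compl] at this
  have hpE : p ∈ E := hfrD hp
  have hNS : ∀ d ∈ D, NS E d x := fun d hd => ns_of_preconnected hE.isClosed hDc hDE hd hxD
  obtain ⟨ρ, hρ, hρ1⟩ : ∃ ρ > 0, ρ < min (min (δ / 2) (ε / 2)) (dist q p) :=
    exists_between (lt_min (lt_min (by linarith) (by linarith)) (dist_pos.2 hqp))
  rw [lt_min_iff, lt_min_iff] at hρ1
  obtain ⟨⟨hρδ, hρε⟩, hρq⟩ := hρ1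
  -- a point of E on the circle
  obtain ⟨θ, hθ⟩ : ∃ θ, cc p ρ θ ∈ E := by
    have h1 : Icc (dist p p) (dist q p) ⊆ (fun z => dist z p) '' E :=
      hEc.intermediate_value hpE hq (f := fun z => dist z p) (by fun_prop)
    obtain ⟨z, hz, hzρ⟩ := h1 (show ρ ∈ _ from ⟨by rw [dist_self]; exact hρ.le, hρq.le⟩)
    obtain ⟨θ, h⟩ := cc_surj p (ρ := ρ) (z := z) hzρ
    exact ⟨θ, by rw [h]; exact hz⟩
  have hxball : x ∉ Metric.closedBall p ε := by
    rw [Metric.mem_closedBall]; exact not_le.2 hεx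
  have hIρ : ∀ {a b}, cc p ρ '' Icc a b ⊆ Metric.sphere p ρ := by
    rintro a b _ ⟨t, _, rfl⟩
    exact cc_mem_sphere p hρ t
  have hxI : ∀ {a b}, x ∉ cc p ρ '' Icc a b := by
    intro a b h
    have := hIρ h
    rw [Metric.mem_sphere] at this
    linarith
  -- points of D far away are not separated by a gap
  have far : ∀ {a b}, Gap E p ρ a b → ∀ d ∈ D, d ∉ Metric.closedBall p ε →
      NS (E ∪ cc p ρ '' Icc a b) d x := by
    intro a b g d hd hdb
    have da := cc_mem_sphere p hρ a
    have db := cc_mem_sphere p hρ b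
    rw [Metric.mem_sphere] at da db
    have dab := dist_triangle_right (cc p ρ a) (cc p ρ b) p
    obtain ⟨L, hLE, hLcl, hLc, haL, hbL, hLb⟩ := hLC _ g.ha _ g.hb (by linarith)
    refine ns_crosscut hE.isClosed g hLcl hLc hLE haL hbL (c := p) (r := ε) ?_ ?_ hdb hxball hx
      (hNS d hd)
    · exact hLb.trans (Metric.closedBall_subset_closedBall' (by linarith))
    · exact hIρ.trans (Metric.sphere_subset_closedBall.trans
        (Metric.closedBall_subset_closedBall (by linarith)))
  -- small gaps do not separate points near p
  obtain ⟨η, hη, small⟩ : ∃ η > 0, ∀ {a b}, Gap E p ρ a b → b - a < η → ∀ d ∈ D,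
      d ∈ Metric.ball p (ρ / 2) → NS (E ∪ cc p ρ '' Icc a b) d x := by
    obtain ⟨δ₁, hδ₁, hLC₁⟩ := hLC1 (show 0 < ρ / 3 by linarith)
    refine ⟨min δ₁ (ρ / 3) / ρ, div_pos (lt_min hδ₁ (by linarith)) hρ, ?_⟩
    intro a b g hlt d hd hdb
    rw [lt_div_iff₀ hρ, lt_min_iff] at hlt
    have hab := g.lt
    have da := cc_mem_sphere p hρ a
    rw [Metric.mem_sphere] at da
    have dab : dist (cc p ρ a) (cc p ρ b) < δ₁ := by
      have := cc_dist p hρ a b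
      rw [abs_sub_comm, abs_of_pos (by linarith)] at this
      linarith [hlt.1]
    obtain ⟨L, hLE, hLcl, hLc, haL, hbL, hLb⟩ := hLC₁ _ g.ha _ g.hb dab
    refine ns_crosscut hE.isClosed g hLcl hLc hLE haL hbL hLb ?_ ?_ ?_ hx (hNS d hd)
    · rintro _ ⟨u, hu, rfl⟩
      rw [Metric.mem_closedBall]
      have h1 := cc_dist p hρ u a
      rw [abs_of_nonneg (by linarith [hu.1])] at h1
      have h2 : ρ * (u - a) ≤ ρ * (b - a) := by
        apply mul_le_mul_of_nonneg_left _ hρ.le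
        linarith [hu.2]
      linarith [hlt.2]
    · rw [Metric.mem_closedBall]
      rw [Metric.mem_ball] at hdb
      have := dist_triangle_left (cc p ρ a) p d
      intro h
      linarith
    · rw [Metric.mem_closedBall]
      have := dist_triangle x (cc p ρ a) p
      intro h
      linarith
  let G : Set (ℝ × ℝ) := {ab : ℝ × ℝ | θ ≤ ab.1 ∧ ab.2 ≤ θ + 2 * Real.pi ∧
    Gap E p ρ ab.1 ab.2 ∧ η ≤ ab.2 - ab.1}
  have hG : G.Finite := gaps_finite hη
  let K : ℝ × ℝ → Set ℂ := fun ab => E ∪ cc p ρ '' Icc ab.1 ab.2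
  let W : ℝ × ℝ → Set (Set ℂ) := fun ab =>
    {U | ∃ d ∈ D, d ∉ K ab ∧ x ∉ connectedComponentIn (K ab)ᶜ d ∧
      U = connectedComponentIn (K ab)ᶜ d}
  have hKc : ∀ ab, IsCompact (K ab) := fun ab => hE.union (arc_compact p ρ ab.1 ab.2)
  have hxK : ∀ ab, x ∉ K ab := by
    rintro ab (h | h)
    · exact hx h
    · exact hxI h
  have hW1 : ∀ ab, ∀ d, IsOpen (connectedComponentIn (K ab)ᶜ d) :=
    fun ab d => (hKc ab).isClosed.isOpen_compl.connectedComponentIn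
  have hWfr : ∀ ab, ∀ d, frontier (connectedComponentIn (K ab)ᶜ d) ⊆ K ab := by
    intro ab d
    have := comp_frontier (hKc ab).isClosed.isOpen_compl d
    rwa [compl_compl] at this
  have hsubD : ∀ ab, ∀ d ∈ D, connectedComponentIn (K ab)ᶜ d ⊆ D := by
    intro ab d hd
    rw [hD] at hd ⊢
    rw [connectedComponentIn_eq hd]
    exact connectedComponentIn_mono _ (compl_subset_compl.2 subset_union_left)
  have hcomp : ∀ ab ∈ G, ∀ d ∈ D, d ∉ K ab → x ∉ connectedComponentIn (K ab)ᶜ d →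
      (∀ t ∈ Ioo ab.1 ab.2, cc p ρ t ∈ closure (connectedComponentIn (K ab)ᶜ d)) ∧
        IsPreconnected (closure (connectedComponentIn (K ab)ᶜ d) ∩ E) := by
    intro ab hab d hd hdK hxU
    refine gap_component hE hEc hab.2.2.1 (hW1 ab d) isPreconnected_connectedComponentIn ?_
      (hWfr ab d) (mem_connectedComponentIn hdK) hxU (hxK ab) (hNS d hd)
    rw [Set.disjoint_left]
    exact fun z hz => connectedComponentIn_subset _ _ hz
  have hWfin : ∀ ab ∈ G, (W ab).Finite := by
    intro ab hab
    obtain ⟨h₁, h₂, h⟩ := gap_sides hE.isClosed hab.2.2.1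
    refine (Set.toFinite {connectedComponentIn (K ab)ᶜ h₁, connectedComponentIn (K ab)ᶜ h₂}).subset ?_
    rintro _ ⟨d, hd, hdK, hxU, rfl⟩
    rcases h d hdK (hcomp ab hab d hd hdK hxU).1 with h | h
    · exact Or.inl h
    · exact Or.inr h
  let 𝒰 : Set (Set ℂ) := ⋃ ab ∈ G, W ab
  have h𝒰 : 𝒰.Finite := hG.biUnion hWfin
  have prop : ∀ U ∈ 𝒰, IsPreconnected (closure U ∩ E) ∧ closure U ∩ E ⊆ frontier D ∧
      closure U ∩ E ⊆ Metric.closedBall p ε := by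
    intro U hU
    simp only [𝒰, mem_iUnion] at hU
    obtain ⟨ab, hab, d, hd, hdK, hxU, rfl⟩ := hU
    refine ⟨(hcomp ab hab d hd hdK hxU).2, ?_, ?_⟩
    · rintro z ⟨hz, hzE⟩
      rw [hDo.frontier_eq]
      exact ⟨closure_mono (hsubD ab d hd) hz, fun h => hDE h hzE⟩
    · refine inter_subset_left.trans (closure_minimal ?_ Metric.isClosed_closedBall)
      intro u hu
      by_contra hcon
      exact not_ns (hKc ab) (hW1 ab d) (hWfr ab d) hu hxU (hxK ab)
        (far hab.2.2.1 u (hsubD ab d hd hu) hcon)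
  have cover1 : D ∩ Metric.ball p (ρ / 2) ⊆ ⋃ U ∈ 𝒰, U := by
    rintro d ⟨hd, hdb⟩
    have hdb' : d ∈ Metric.ball p ρ := Metric.ball_subset_ball (by linarith) hdb
    obtain ⟨a, b, h1, h2, g, hn⟩ := exists_gap hE hEc hρ hθ hdb'
      (fun h => hxball (Metric.closedBall_subset_closedBall (by linarith) h)) hx (hNS d hd)
    have hbig : η ≤ b - a := by
      by_contra h
      exact hn (small g (not_le.1 h) d hd hdb)
    have hdK : d ∉ K (a, b) := by
      rintro (h | h)
      · exact hDE hd h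
      · have := hIρ h
        rw [Metric.mem_sphere] at this
        rw [Metric.mem_ball] at hdb'
        linarith
    have hxU : x ∉ connectedComponentIn (K (a, b))ᶜ d := by
      intro h
      exact hn (ns_of_preconnected (hKc (a, b)).isClosed isPreconnected_connectedComponentIn
        (connectedComponentIn_subset _ _) (mem_connectedComponentIn hdK) h)
    simp only [𝒰, mem_iUnion]
    exact ⟨_, ⟨(a, b), ⟨h1, h2, g, hbig⟩, d, hd, hdK, hxU, rfl⟩, mem_connectedComponentIn hdK⟩
  have cover2 : ∀ z ∈ frontier D ∩ Metric.ball p (ρ / 2), ∃ U ∈ 𝒰, z ∈ closure U ∩ E := by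
    rintro z ⟨hz, hzb⟩
    have h1 : z ∈ closure (D ∩ Metric.ball p (ρ / 2)) := by
      have := Metric.isOpen_ball.inter_closure ⟨hzb, frontier_subset_closure hz⟩
      rwa [inter_comm]
    have h2 := closure_mono cover1 h1
    rw [h𝒰.closure_biUnion] at h2
    simp only [mem_iUnion] at h2
    obtain ⟨U, hU, hzU⟩ := h2
    exact ⟨U, hU, hzU, hfrD hz⟩
  let 𝒜 : Set (Set ℂ) := {F | ∃ U ∈ 𝒰, F = closure U ∩ E ∧ p ∈ F}
  have hbad : IsClosed (⋃ U ∈ {U ∈ 𝒰 | p ∉ closure U ∩ E}, closure U ∩ E) :=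
    (h𝒰.subset (fun U hU => hU.1)).isClosed_biUnion
      (fun U _ => isClosed_closure.inter hE.isClosed)
  obtain ⟨r, hr, hrb⟩ := Metric.isOpen_iff.1 hbad.isOpen_compl p (by
    intro h
    simp only [mem_iUnion] at h
    obtain ⟨U, hU, h⟩ := h
    exact hU.2 h)
  refine ⟨⋃₀ 𝒜, ?_, ?_, isPreconnected_sUnion p 𝒜 ?_ ?_, min r (ρ / 2),
    lt_min hr (by linarith), ?_⟩
  · rintro z ⟨_, ⟨U, hU, rfl, _⟩, hz⟩
    exact (prop U hU).2.1 hz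
  · rintro z ⟨_, ⟨U, hU, rfl, _⟩, hz⟩
    exact (prop U hU).2.2 hz
  · rintro _ ⟨U, hU, rfl, h⟩
    exact h
  · rintro _ ⟨U, hU, rfl, h⟩
    exact (prop U hU).1
  · rintro z ⟨hz, hzb⟩
    obtain ⟨U, hU, hzU⟩ := cover2 z ⟨hz, Metric.ball_subset_ball (min_le_right _ _) hzb⟩
    refine ⟨_, ⟨U, hU, rfl, ?_⟩, hzU⟩
    by_contra hpU
    refine hrb (Metric.ball_subset_ball (min_le_left _ _) hzb) ?_
    simp only [mem_iUnion]
    exact ⟨U, ⟨hU, hpU⟩, hzU⟩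

/-- If `D` is a connected component of the complement of the image of a
continuous curve `γ : [0,1] → ℂ`, then the boundary of `D` is locally
connected. -/
theorem boundary_locallyConnected_of_curve_complement
    (γ : ℝ → ℂ) (hγ : ContinuousOn γ (Icc 0 1))
    (D : Set ℂ) (x : ℂ) (hx : x ∈ (γ '' Icc 0 1)ᶜ)
    (hD : D = connectedComponentIn (γ '' Icc 0 1)ᶜ x) :
    LocallyConnectedSpace (frontier D) := by
  subst hD
  have hfrD : frontier (connectedComponentIn (γ '' Icc 0 1)ᶜ x) ⊆ γ '' Icc 0 1 := by
    have := comp_frontier (isCompact_Icc.image_of_continuousOn hγ).isClosed.isOpen_compl x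
    rwa [compl_compl] at this
  rw [locallyConnectedSpace_iff_connected_subsets]
  rintro ⟨p, hp⟩ N hN
  obtain ⟨ε, hε, hεN⟩ := Metric.mem_nhds_iff.1 hN
  by_cases hq : ∃ q ∈ γ '' Icc 0 1, q ≠ p
  · obtain ⟨q, hq, hqp⟩ := hq
    have hxp : 0 < dist x p := dist_pos.2 (fun h => hx (h ▸ hfrD hp))
    obtain ⟨ε', hε', hlt⟩ := exists_between (lt_min hε hxp)
    rw [lt_min_iff] at hlt
    obtain ⟨V, hV, hVb, hVc, r, hr, hrV⟩ := core hγ hx hp hε' hlt.2 hq hqp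
    refine ⟨Subtype.val ⁻¹' V, ?_, ?_, ?_⟩
    · refine Metric.mem_nhds_iff.2 ⟨r, hr, fun z hz => hrV ⟨z.2, hz⟩⟩
    · rw [← Topology.IsInducing.subtypeVal.isPreconnected_image, Subtype.image_preimage_coe,
        inter_eq_right.2 hV]
      exact hVc
    · intro z hz
      apply hεN
      have := hVb hz
      rw [Metric.mem_closedBall] at this
      rw [Metric.mem_ball, Subtype.dist_eq]
      exact this.trans_lt hlt.1
  · push Not at hq
    refine ⟨univ, Filter.univ_mem, ?_, ?_⟩
    · apply Set.Subsingleton.isPreconnected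
      rintro ⟨a, ha⟩ _ ⟨b, hb⟩ _
      rw [Subtype.mk.injEq, hq a (hfrD ha), hq b (hfrD hb)]
    · rintro ⟨a, ha⟩ _
      have : (⟨a, ha⟩ : frontier (connectedComponentIn (γ '' Icc 0 1)ᶜ x)) = ⟨p, hp⟩ :=
        Subtype.ext (hq a (hfrD ha))
      rw [this]
      exact mem_of_mem_nhds hN
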